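/- Let d ≥ 3 and let G : Z^d → ℝ be the lattice Green's function, i.e. the unique function satisfying −ΔG = δ₀ on Z^d (with Δ the discrete Laplacian Δu(x) = ∑_{y∼x}(u(y) − u(x))) and G(x) → 0 as |x| → ∞. Then there exist constants c = c(d) > 0 and C = C(d) < ∞ such that for all x ∈ Z^d, c/(|x|+1)^{d−2} ≤ G(x) ≤ C/(|x|+1)^{d−2}, and moreover |∇G(x)| ≤ C/(|x|+1)^{d−1}, where ∇G(x) = (G(x+e_i) − G(x))_{1≤i≤d}. -/

import Mathlib

/-- The Euclidean norm of a point of the lattice `ℤ^d`. -/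
noncomputable def latNorm {d : ℕ} (x : Fin d → ℤ) : ℝ :=
  Real.sqrt (∑ i, ((x i : ℝ)) ^ 2)

namespace LatticeGreen

open Filter Topology

variable {d : ℕ}

/-- The discrete Laplacian on `ℤ^d`. -/
def lap (u : (Fin d → ℤ) → ℝ) (x : Fin d → ℤ) : ℝ :=
  ∑ i : Fin d, (u (x + Pi.single i 1) + u (x - Pi.single i 1) - 2 * u x)

/-- The squared Euclidean norm. -/
def sqNorm (x : Fin d → ℤ) : ℝ := ∑ i, (x i : ℝ) ^ 2

lemma sqNorm_nonneg (x : Fin d → ℤ) : 0 ≤ sqNorm x :=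
  Finset.sum_nonneg fun _ _ => sq_nonneg _

lemma sq_le_sqNorm (x : Fin d → ℤ) (i : Fin d) : (x i : ℝ) ^ 2 ≤ sqNorm x :=
  Finset.single_le_sum (f := fun i => (x i : ℝ) ^ 2) (fun _ _ => sq_nonneg _) (Finset.mem_univ i)

lemma latNorm_nonneg (x : Fin d → ℤ) : 0 ≤ latNorm x := Real.sqrt_nonneg _

lemma latNorm_sq (x : Fin d → ℤ) : latNorm x ^ 2 = sqNorm x := Real.sq_sqrt (sqNorm_nonneg x)

lemma latNorm_zero : latNorm (0 : Fin d → ℤ) = 0 := by simp [latNorm]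

lemma latNorm_eq_norm (x : Fin d → ℤ) :
    latNorm x = ‖(WithLp.toLp 2 fun i => (x i : ℝ) : EuclideanSpace ℝ (Fin d))‖ := by
  simp [latNorm, EuclideanSpace.norm_eq]

lemma latNorm_add_le (x y : Fin d → ℤ) : latNorm (x + y) ≤ latNorm x + latNorm y := by
  simp only [latNorm_eq_norm]
  refine le_trans (le_of_eq ?_) (norm_add_le _ _)
  congr 1
  ext i
  simp

lemma latNorm_neg (x : Fin d → ℤ) : latNorm (-x) = latNorm x := by simp [latNorm]

lemma latNorm_single (i : Fin d) : latNorm (Pi.single i (1 : ℤ)) = 1 := by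
  have h : ∀ j, ((Pi.single i (1 : ℤ) : Fin d → ℤ) j : ℝ) ^ 2 = if j = i then 1 else 0 := by
    intro j
    by_cases hj : j = i
    · subst hj; simp
    · simp [hj]
  simp [latNorm, h]

lemma sqNorm_add_single (x : Fin d → ℤ) (i : Fin d) (a : ℤ) :
    sqNorm (x + Pi.single i a) = sqNorm x + 2 * a * x i + a ^ 2 := by
  have h : ∀ j, ((x + Pi.single i a : Fin d → ℤ) j : ℝ) ^ 2
      = (x j : ℝ) ^ 2 + if j = i then 2 * a * x i + (a : ℝ) ^ 2 else 0 := by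
    intro j
    by_cases hj : j = i
    · subst hj; simp; ring
    · simp [hj]
  simp only [sqNorm, h, Finset.sum_add_distrib]
  simp
  ring

lemma sqNorm_add_single_one (x : Fin d → ℤ) (i : Fin d) :
    sqNorm (x + Pi.single i 1) = sqNorm x + 2 * x i + 1 := by
  simpa using sqNorm_add_single x i 1

lemma sqNorm_sub_single_one (x : Fin d → ℤ) (i : Fin d) :
    sqNorm (x - Pi.single i 1) = sqNorm x - 2 * x i + 1 := by
  have h := sqNorm_add_single x i (-1)
  rw [Pi.single_neg, ← sub_eq_add_neg] at h
  rw [h]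
  push_cast
  ring

lemma finite_sqNorm_le (B : ℝ) : {x : Fin d → ℤ | sqNorm x ≤ B}.Finite := by
  refine (Set.finite_Icc (fun _ : Fin d => -⌈B⌉) (fun _ => ⌈B⌉)).subset ?_
  intro x hx
  have hx' : sqNorm x ≤ B := hx
  have h : ∀ i, |x i| ≤ ⌈B⌉ := fun i => by
    have h1 : ((x i ^ 2 : ℤ) : ℝ) ≤ ⌈B⌉ := by
      push_cast
      exact ((sq_le_sqNorm x i).trans hx').trans (Int.le_ceil B)
    have h2 : x i ^ 2 ≤ ⌈B⌉ := by exact_mod_cast h1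
    refine le_trans ?_ h2
    rw [← sq_abs]
    rcases (abs_nonneg (x i)).eq_or_lt with h0 | h0
    · rw [← h0]; norm_num
    · nlinarith
  exact ⟨fun i => (abs_le.1 (h i)).1, fun i => (abs_le.1 (h i)).2⟩

lemma lap_sub (u v : (Fin d → ℤ) → ℝ) (x : Fin d → ℤ) :
    lap (fun y => u y - v y) x = lap u x - lap v x := by
  simp only [lap, ← Finset.sum_sub_distrib]
  exact Finset.sum_congr rfl fun _ _ => by ring

lemma lap_add (u v : (Fin d → ℤ) → ℝ) (x : Fin d → ℤ) :
    lap (fun y => u y + v y) x = lap u x + lap v x := by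
  simp only [lap, ← Finset.sum_add_distrib]
  exact Finset.sum_congr rfl fun _ _ => by ring

lemma lap_const_mul (c : ℝ) (u : (Fin d → ℤ) → ℝ) (x : Fin d → ℤ) :
    lap (fun y => c * u y) x = c * lap u x := by
  simp only [lap, Finset.mul_sum]
  exact Finset.sum_congr rfl fun _ _ => by ring

/-- If `u` is subharmonic wherever it is positive, and tends to `0` at infinity from above,
then `u ≤ 0`. -/
theorem nonpos_of_subharmonic_of_finite (hd : 0 < d) {u : (Fin d → ℤ) → ℝ}
    (hfin : ∀ ε > 0, {x | ε < u x}.Finite) (hsub : ∀ x, 0 < u x → 0 ≤ lap u x)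
    (x : Fin d → ℤ) : u x ≤ 0 := by
  by_contra! hx
  obtain ⟨a, ha, hmax⟩ := Set.exists_max_image {y | u x / 2 < u y} u (hfin _ (half_pos hx))
    ⟨x, show u x / 2 < u x by linarith⟩
  have hle : ∀ y, u y ≤ u a := by
    intro y
    by_cases hy : u x / 2 < u y
    · exact hmax y hy
    · exact (not_lt.1 hy).trans (le_of_lt ha)
  have hpos : 0 < u a := hx.trans_le (hle x)
  have hne : {y | u y = u a}.Finite := (hfin _ (half_pos hpos)).subset fun y hy => by
    have hy' : u y = u a := hy
    show u a / 2 < u y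
    linarith
  let i₀ : Fin d := ⟨0, hd⟩
  obtain ⟨b, hb, hbmax⟩ := Set.exists_max_image {y | u y = u a} (fun y => y i₀) hne ⟨a, rfl⟩
  have hb' : u b = u a := hb
  have hlap := hsub b (hb' ▸ hpos)
  have hterm : ∀ i ∈ Finset.univ,
      u (b + Pi.single i 1) + u (b - Pi.single i 1) - 2 * u b ≤ 0 := fun i _ => by
    have h1 := hle (b + Pi.single i 1)
    have h2 := hle (b - Pi.single i 1)
    linarith
  have hzero := (Finset.sum_eq_zero_iff_of_nonpos hterm).1
    (le_antisymm (Finset.sum_nonpos hterm) hlap) i₀ (Finset.mem_univ _)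
  have hmem : u (b + Pi.single i₀ 1) = u a := by
    have h1 := hle (b + Pi.single i₀ 1)
    have h2 := hle (b - Pi.single i₀ 1)
    linarith
  have := hbmax _ hmem
  simp at this

lemma exists_abs_one_add_rpow_sub_le (a : ℝ) : ∃ K > 0, ∃ δ > 0, δ ≤ 1 ∧ ∀ u : ℝ, |u| ≤ δ →
    |(1 + u) ^ a - (1 + a * u + a * (a - 1) / 2 * u ^ 2)| ≤ K * |u| ^ 3 := by
  have h := (Real.one_add_rpow_hasFPowerSeriesAt_zero (a := a)).isBigO_sub_partialSum_pow 3
  obtain ⟨K, hK, hb⟩ := h.exists_pos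
  obtain ⟨δ, hδ, hball⟩ := Metric.eventually_nhds_iff.1 hb.bound
  refine ⟨K, hK, min (δ / 2) 1, by positivity,
    min_le_right _ _, fun u hu => ?_⟩
  have := hball (y := u) (by
    rw [dist_zero_right, Real.norm_eq_abs]
    exact (hu.trans (min_le_left _ _)).trans_lt (by linarith))
  have hc : Ring.choose a 2 = a * (a - 1) / 2 := by
    rw [Ring.choose_eq_smul, show 2 = 1 + 1 from rfl, descPochhammer_succ_right]
    simp [Polynomial.smeval_mul, Polynomial.smeval_sub, Polynomial.smeval_X]
    ring
  simp [FormalMultilinearSeries.partialSum, Finset.sum_range_succ, binomialSeries, hc] at this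
  convert this using 2
  ring

/-- A power of the smoothed norm `√(|x|² + 1)`. -/
noncomputable def normPow (γ : ℝ) (x : Fin d → ℤ) : ℝ := (sqNorm x + 1) ^ (-γ)

lemma normPow_pos (γ : ℝ) (x : Fin d → ℤ) : 0 < normPow γ x :=
  Real.rpow_pos_of_pos (by linarith [sqNorm_nonneg x]) _

/-- Expansion of the Laplacian of a power of the norm; `r⁴ = |x|² + 1`. -/
lemma exists_abs_lap_normPow_sub_le (γ : ℝ) : ∃ K > 0, ∃ r₀ ≥ 1, ∀ (x : Fin d → ℤ) (r : ℝ),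
    r₀ ≤ r → r ^ 4 = sqNorm x + 1 →
    |lap (normPow γ) x - normPow γ x * (2 * γ * (2 * γ + 2 - d) / r ^ 4)|
      ≤ normPow γ x * (K / r ^ 6) := by
  obtain ⟨K, hK, δ, hδ, hδ1, hT⟩ := exists_abs_one_add_rpow_sub_le (-γ)
  have hd0 : (0 : ℝ) ≤ d := Nat.cast_nonneg d
  refine ⟨54 * d * K + |γ * (γ + 1)| * (d + 4) + 1, by positivity, max 1 (3 / δ),
    le_max_left _ _, fun x r hr hs => ?_⟩
  have hr1 : 1 ≤ r := (le_max_left _ _).trans hr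
  have hr0 : 0 < r := by linarith
  have hrδ : 3 / r ^ 2 ≤ δ := by
    have h1 : 3 / δ ≤ r := (le_max_right _ _).trans hr
    rw [div_le_iff₀ hδ] at h1
    rw [div_le_iff₀ (by positivity)]
    nlinarith [mul_nonneg hδ.le (mul_nonneg hr0.le (sub_nonneg.2 hr1))]
  set P : ℝ → ℝ := fun u => 1 + -γ * u + -γ * (-γ - 1) / 2 * u ^ 2 with hP
  have key : ∀ (b : ℝ) (y : Fin d → ℤ), sqNorm y = sqNorm x + 2 * b + 1 → b ^ 2 ≤ sqNorm x →
      |normPow γ y - normPow γ x * P ((1 + 2 * b) / r ^ 4)| ≤ normPow γ x * (27 * K / r ^ 6) := by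
    intro b y hy hb
    set u := (1 + 2 * b) / r ^ 4 with hu
    have hbr : |b| ≤ r ^ 2 := abs_le_of_sq_le_sq (by nlinarith) (by positivity)
    have hur : |u| ≤ 3 / r ^ 2 := by
      rw [hu, abs_div, abs_of_pos (by positivity : 0 < r ^ 4), div_le_div_iff₀ (by positivity)
        (by positivity)]
      have h1 : |1 + 2 * b| ≤ 3 * r ^ 2 := by
        have := abs_le.1 hbr
        rw [abs_le]
        constructor <;> nlinarith
      calc |1 + 2 * b| * r ^ 2 ≤ 3 * r ^ 2 * r ^ 2 := by gcongr
        _ = 3 * r ^ 4 := by ring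
    have huδ := hur.trans hrδ
    have hu1 : 0 ≤ 1 + u := by linarith [(abs_le.1 huδ).1]
    have hsplit : normPow γ y = normPow γ x * (1 + u) ^ (-γ) := by
      rw [normPow, normPow, ← Real.mul_rpow (by linarith [sqNorm_nonneg x]) hu1, hy, ← hs, hu]
      congr 1
      field_simp
      linarith
    rw [hsplit, ← mul_sub, abs_mul, abs_of_pos (normPow_pos γ x)]
    refine mul_le_mul_of_nonneg_left ((hT u huδ).trans ?_) (normPow_pos γ x).le
    calc K * |u| ^ 3 ≤ K * (3 / r ^ 2) ^ 3 := by gcongr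
      _ = 27 * K / r ^ 6 := by field_simp; ring
  have hsumP : ∑ i : Fin d, (P ((1 + 2 * x i) / r ^ 4) + P ((1 + 2 * (-x i)) / r ^ 4) - 2)
      = 2 * γ * (2 * γ + 2 - d) / r ^ 4 + γ * (γ + 1) * (d - 4) / r ^ 8 := by
    have h : ∀ i : Fin d, P ((1 + 2 * x i) / r ^ 4) + P ((1 + 2 * (-x i)) / r ^ 4) - 2
        = (-2 * γ / r ^ 4 + γ * (γ + 1) / r ^ 8) + 4 * γ * (γ + 1) / r ^ 8 * (x i : ℝ) ^ 2 := by
      intro i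
      simp only [hP]
      field_simp
      ring
    rw [Finset.sum_congr rfl fun i _ => h i, Finset.sum_add_distrib, ← Finset.mul_sum]
    have : ∑ i, (x i : ℝ) ^ 2 = r ^ 4 - 1 := by rw [hs, sqNorm]; ring
    rw [this]
    simp
    field_simp
    ring
  have hmain : |lap (normPow γ) x - normPow γ x *
      ∑ i : Fin d, (P ((1 + 2 * x i) / r ^ 4) + P ((1 + 2 * (-x i)) / r ^ 4) - 2)|
      ≤ d * (normPow γ x * (54 * K / r ^ 6)) := by
    rw [lap, Finset.mul_sum, ← Finset.sum_sub_distrib]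
    refine (Finset.abs_sum_le_sum_abs _ _).trans ?_
    refine (Finset.sum_le_card_nsmul _ _ (normPow γ x * (54 * K / r ^ 6)) fun i _ => ?_).trans
      (by simp)
    have h1 := key (x i) _ (sqNorm_add_single_one x i) (sq_le_sqNorm x i)
    have h2 := key (-x i) _ (by rw [sqNorm_sub_single_one x i]; ring)
      (by simpa using sq_le_sqNorm x i)
    have h3 := (abs_add_le _ _).trans (add_le_add h1 h2)
    refine le_trans (le_of_eq ?_) (h3.trans (le_of_eq ?_))
    · congr 1; ring
    · ring
  have h8 : |γ * (γ + 1) * (d - 4) / r ^ 8| ≤ |γ * (γ + 1)| * (d + 4) / r ^ 6 := by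
    rw [abs_div, abs_mul, abs_of_pos (by positivity : 0 < r ^ 8)]
    have h4 : |(d : ℝ) - 4| ≤ d + 4 := by
      rw [abs_le]
      constructor <;> linarith
    have h6 : r ^ 6 ≤ r ^ 8 := pow_le_pow_right₀ hr1 (by norm_num)
    gcongr
  rw [hsumP] at hmain
  have hn := normPow_pos γ x
  set N := normPow γ x
  calc |lap (normPow γ) x - N * (2 * γ * (2 * γ + 2 - d) / r ^ 4)|
      = |(lap (normPow γ) x - N * (2 * γ * (2 * γ + 2 - d) / r ^ 4
          + γ * (γ + 1) * (d - 4) / r ^ 8)) + N * (γ * (γ + 1) * (d - 4) / r ^ 8)| := by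
        congr 1; ring
    _ ≤ d * (N * (54 * K / r ^ 6)) + N * (|γ * (γ + 1)| * (d + 4) / r ^ 6) := by
        refine (abs_add_le _ _).trans (add_le_add hmain ?_)
        rw [abs_mul, abs_of_pos hn]
        gcongr
    _ = N * ((54 * d * K + |γ * (γ + 1)| * (d + 4)) / r ^ 6) := by ring
    _ ≤ _ := mul_le_mul_of_nonneg_left
        (div_le_div_of_nonneg_right (by linarith) (by positivity)) hn.le

/-- The exponent correction `1/4` gives explicit sub- and supersolutions outside a ball. -/
lemma exists_barriers (hd : 3 ≤ d) : ∃ r₀ ≥ 1, ∀ (x : Fin d → ℤ), r₀ ≤ sqNorm x + 1 →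
    0 ≤ lap (fun y => normPow ((d - 2) / 2) y + normPow ((d - 2) / 2 + 1 / 4) y) x ∧
    lap (fun y => normPow ((d - 2) / 2) y - 1 / 2 * normPow ((d - 2) / 2 + 1 / 4) y) x ≤ 0 := by
  set β : ℝ := ((d : ℝ) - 2) / 2 with hβ
  have hd' : (3 : ℝ) ≤ d := by exact_mod_cast hd
  have hβ0 : 0 < β := by rw [hβ]; linarith
  obtain ⟨K, hK, r₁, hr₁, h1⟩ := exists_abs_lap_normPow_sub_le (d := d) β
  obtain ⟨K', hK', r₂, hr₂, h2⟩ := exists_abs_lap_normPow_sub_le (d := d) (β + 1 / 4)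
  set ρ := max (max r₁ r₂) ((2 * K + K') / β) with hρ
  have hρ1 : 1 ≤ ρ := hr₁.trans ((le_max_left _ _).trans (le_max_left _ _))
  refine ⟨ρ ^ 4, one_le_pow₀ hρ1, fun x hx => ?_⟩
  have hs : 0 < sqNorm x + 1 := by linarith [sqNorm_nonneg x]
  set r := (sqNorm x + 1) ^ (1 / 4 : ℝ) with hr
  have hr0 : 0 < r := Real.rpow_pos_of_pos hs _
  have hr4 : r ^ 4 = sqNorm x + 1 := by
    rw [hr, ← Real.rpow_natCast, ← Real.rpow_mul hs.le]
    norm_num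
  have hρr : ρ ≤ r := le_of_pow_le_pow_left₀ (by norm_num : 4 ≠ 0) hr0.le (hr4 ▸ hx)
  have hr1 : 1 ≤ r := hρ1.trans hρr
  have hN : normPow (β + 1 / 4) x = normPow β x / r := by
    rw [normPow, normPow, neg_add, Real.rpow_add hs, Real.rpow_neg hs.le (1 / 4), ← hr,
      div_eq_mul_inv]
  have e1 := h1 x r (((le_max_left _ _).trans (le_max_left _ _)).trans hρr) hr4
  have e2 := h2 x r (((le_max_right _ _).trans (le_max_left _ _)).trans hρr) hr4
  have hβr : 2 * K + K' ≤ β * r := by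
    have : (2 * K + K') / β ≤ r := (le_max_right _ _).trans hρr
    rw [div_le_iff₀ hβ0] at this
    linarith
  have c1 : 2 * β * (2 * β + 2 - d) / r ^ 4 = 0 := by rw [hβ]; ring
  have c2 : 2 * (β + 1 / 4) * (2 * (β + 1 / 4) + 2 - d) / r ^ 4 = (β + 1 / 4) / r ^ 4 := by
    rw [hβ]; ring
  rw [c1, mul_zero, sub_zero] at e1
  rw [c2, hN] at e2
  have hn := normPow_pos β x
  rw [lap_add, lap_sub, lap_const_mul]
  set N := normPow β x
  have f1 := abs_le.1 e1
  have f2 := (abs_le.1 e2).1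
  have hlow : N / r ^ 6 * (2 * K) ≤ lap (normPow (β + 1 / 4)) x := by
    have g1 : N / r ^ 6 * (β * r - K') ≤
        N / r * ((β + 1 / 4) / r ^ 4) - N / r * (K' / r ^ 6) := by
      have : N / r * ((β + 1 / 4) / r ^ 4) - N / r * (K' / r ^ 6)
          = N / r ^ 6 * ((β + 1 / 4) * r - K' / r) := by
        field_simp
      rw [this]
      have : K' / r ≤ K' := div_le_self hK'.le hr1
      gcongr
      linarith
    have g2 : N / r ^ 6 * (2 * K) ≤ N / r ^ 6 * (β * r - K') := by
      gcongr
      linarith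
    linarith
  have hNK : N * (K / r ^ 6) = N / r ^ 6 * K := by ring
  have hpos : 0 ≤ N / r ^ 6 * K := by positivity
  rw [hNK] at f1
  exact ⟨by linarith [f1.1], by linarith [f1.2]⟩

lemma finite_lt_normPow {γ : ℝ} (hγ : 0 < γ) {ε : ℝ} (hε : 0 < ε) :
    {x : Fin d → ℤ | ε < normPow γ x}.Finite := by
  obtain ⟨B, hB⟩ := eventually_atTop.1 ((tendsto_rpow_neg_atTop hγ).eventually (gt_mem_nhds hε))
  refine (finite_sqNorm_le B).subset fun x hx => ?_
  by_contra hxB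
  have hxB' : B < sqNorm x := not_le.1 hxB
  exact lt_asymm hx (hB (sqNorm x + 1) (by linarith))

lemma normPow_add_le {γ δ : ℝ} (hδ : 0 ≤ δ) (x : Fin d → ℤ) :
    normPow (γ + δ) x ≤ normPow γ x :=
  Real.rpow_le_rpow_of_exponent_le (by linarith [sqNorm_nonneg x]) (by linarith)

/-- A nonnegative decaying solution of `-Δ G = δ₀` is positive. -/
lemma pos_of_lap_eq {G : (Fin d → ℤ) → ℝ} (hG : ∀ x, lap G x = if x = 0 then -1 else 0)
    (hG0 : ∀ x, 0 ≤ G x) (x : Fin d → ℤ) : 0 < G x := by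
  have hterm : ∀ y, G y = 0 → ∀ i ∈ Finset.univ,
      0 ≤ G (y + Pi.single i 1) + G (y - Pi.single i 1) - 2 * G y := fun y hy i _ => by
    rw [hy]
    linarith [hG0 (y + Pi.single i 1), hG0 (y - Pi.single i 1)]
  have hne : G 0 ≠ 0 := fun h => by
    have h1 : 0 ≤ lap G 0 := Finset.sum_nonneg (hterm 0 h)
    rw [hG, if_pos rfl] at h1
    linarith
  have hstep : ∀ y, G y = 0 → ∀ i, G (y + Pi.single i 1) = 0 ∧ G (y - Pi.single i 1) = 0 := by
    intro y hy i
    have h1 : lap G y = 0 := by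
      rw [hG, if_neg]
      rintro rfl
      exact hne hy
    have h2 := (Finset.sum_eq_zero_iff_of_nonneg (hterm y hy)).1 h1 i (Finset.mem_univ _)
    rw [hy] at h2
    have h3 := hG0 (y + Pi.single i 1)
    have h4 := hG0 (y - Pi.single i 1)
    constructor <;> linarith
  have hline : ∀ i (n : ℤ) y, G y = 0 → G (y + Pi.single i n) = 0 := by
    intro i n
    induction n using Int.induction_on with
    | zero => intro y hy; simpa using hy
    | succ n ih =>
      intro y hy
      rw [Pi.single_add, ← add_assoc]
      exact (hstep _ (ih y hy) i).1
    | pred n ih =>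
      intro y hy
      rw [Pi.single_sub, ← add_sub_assoc]
      exact (hstep _ (ih y hy) i).2
  have hall : ∀ (s : Finset (Fin d)) (z y : Fin d → ℤ), G y = 0 →
      G (y + ∑ i ∈ s, Pi.single i (z i)) = 0 := by
    intro s z
    induction s using Finset.induction_on with
    | empty => intro y hy; simpa using hy
    | insert i s hi ih =>
      intro y hy
      rw [Finset.sum_insert hi, ← add_assoc]
      exact ih _ (hline i _ y hy)
  refine (hG0 x).lt_of_ne' fun hx => hne ?_
  have h := hall Finset.univ (-x) x hx
  rwa [Finset.univ_sum_single, add_neg_cancel] at h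

/-- Two-sided comparison of the Green's function with `(|x|² + 1)^{-(d-2)/2}`. -/
theorem exists_green_bounds (hd : 3 ≤ d) {G : (Fin d → ℤ) → ℝ}
    (hG : ∀ x, lap G x = if x = 0 then -1 else 0)
    (hfin : ∀ ε > 0, {x | ε < |G x|}.Finite) :
    ∃ c > 0, ∃ C > 0, ∀ x, c * normPow ((d - 2) / 2) x ≤ G x ∧
      G x ≤ C * normPow ((d - 2) / 2) x := by
  have hd0 : 0 < d := by omega
  have hd' : (3 : ℝ) ≤ d := by exact_mod_cast hd
  have hG0 : ∀ x, 0 ≤ G x := fun x => by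
    have h := nonpos_of_subharmonic_of_finite hd0 (u := fun y => (-1) * G y)
      (fun ε hε => (hfin ε hε).subset fun y hy => by
        have hy' : ε < -1 * G y := hy
        exact lt_of_lt_of_le (by linarith) (neg_le_abs (G y)))
      (fun y _ => by
        rw [lap_const_mul, hG]
        split_ifs <;> norm_num) x
    linarith
  have hGpos := pos_of_lap_eq hG hG0
  have hGfin : ∀ ε > 0, {x | ε < G x}.Finite := fun ε hε =>
    (hfin ε hε).subset fun y hy => by
      have hy' : ε < G y := hy
      exact lt_of_lt_of_le hy' (le_abs_self _)
  obtain ⟨r₀, hr₀, hbar⟩ := exists_barriers hd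
  set β : ℝ := ((d : ℝ) - 2) / 2 with hβ
  have hβ0 : 0 < β := by rw [hβ]; linarith
  have hfinN : ∀ ε > 0, {x : Fin d → ℤ | ε < normPow β x}.Finite := fun ε hε =>
    finite_lt_normPow hβ0 hε
  have hcmp : ∀ x : Fin d → ℤ, normPow (β + 1 / 4) x ≤ normPow β x := fun x =>
    normPow_add_le (by norm_num) x
  have hball : {x : Fin d → ℤ | sqNorm x + 1 ≤ r₀}.Finite :=
    (finite_sqNorm_le (r₀ - 1)).subset fun x hx => by
      have hx' : sqNorm x + 1 ≤ r₀ := hx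
      show sqNorm x ≤ r₀ - 1
      linarith
  have hball0 : (0 : Fin d → ℤ) ∈ {x : Fin d → ℤ | sqNorm x + 1 ≤ r₀} := by
    simp [sqNorm]
    linarith
  have hlapG : ∀ x : Fin d → ℤ, r₀ < sqNorm x + 1 → lap G x = 0 := by
    intro x hx
    rw [hG, if_neg]
    rintro rfl
    exact absurd hball0 (not_le.2 hx)
  obtain ⟨a, -, ha⟩ := Set.exists_min_image _
    (fun x => G x / (normPow β x + normPow (β + 1 / 4) x)) hball ⟨0, hball0⟩
  obtain ⟨b, -, hb⟩ := Set.exists_max_image _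
    (fun x => G x / (normPow β x - 1 / 2 * normPow (β + 1 / 4) x)) hball ⟨0, hball0⟩
  have hden : ∀ x : Fin d → ℤ, 0 < normPow β x + normPow (β + 1 / 4) x := fun x =>
    add_pos (normPow_pos _ _) (normPow_pos _ _)
  have hden' : ∀ x : Fin d → ℤ, 0 < normPow β x - 1 / 2 * normPow (β + 1 / 4) x := fun x => by
    linarith [hcmp x, normPow_pos β x]
  set c := G a / (normPow β a + normPow (β + 1 / 4) a)
  set C := G b / (normPow β b - 1 / 2 * normPow (β + 1 / 4) b)
  have hc : 0 < c := div_pos (hGpos a) (hden a)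
  have hC : 0 < C := div_pos (hGpos b) (hden' b)
  refine ⟨c, hc, C, hC, fun x => ⟨?_, ?_⟩⟩
  · have h := nonpos_of_subharmonic_of_finite hd0
      (u := fun y => c * (normPow β y + normPow (β + 1 / 4) y) - G y)
      (fun ε hε => (hfinN (ε / (2 * c)) (by positivity)).subset fun y hy => by
        have hy' : ε < c * (normPow β y + normPow (β + 1 / 4) y) - G y := hy
        show ε / (2 * c) < normPow β y
        rw [div_lt_iff₀ (by positivity)]
        nlinarith [mul_le_mul_of_nonneg_left (hcmp y) hc.le, hG0 y])
      (fun y hy => by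
        rw [lap_sub, lap_const_mul]
        have hy' : r₀ < sqNorm y + 1 := by
          by_contra! hyr
          have := ha y hyr
          rw [le_div_iff₀ (hden y)] at this
          linarith
        rw [hlapG y hy', sub_zero]
        exact mul_nonneg hc.le (hbar y hy'.le).1) x
    nlinarith [mul_pos hc (normPow_pos (β + 1 / 4) x)]
  · have h := nonpos_of_subharmonic_of_finite hd0
      (u := fun y => G y - C * (normPow β y - 1 / 2 * normPow (β + 1 / 4) y))
      (fun ε hε => (hGfin ε hε).subset fun y hy => by
        have hy' : ε < G y - C * (normPow β y - 1 / 2 * normPow (β + 1 / 4) y) := hy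
        show ε < G y
        linarith [mul_pos hC (hden' y)])
      (fun y hy => by
        rw [lap_sub, lap_const_mul]
        have hy' : r₀ < sqNorm y + 1 := by
          by_contra! hyr
          have := hb y hyr
          rw [div_le_iff₀ (hden' y)] at this
          linarith
        rw [hlapG y hy', zero_sub, neg_nonneg]
        exact mul_nonpos_of_nonneg_of_nonpos hC.le (hbar y hy'.le).2) x
    nlinarith [mul_pos hC (normPow_pos (β + 1 / 4) x)]

lemma cutoff_mul_sq_sub_ge {η η' v v' L : ℝ} (hη' : 0 < η') (hL : (η' - η) ^ 2 ≤ L * η') :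
    (η' - η) * v ^ 2 + 2 * η * v * (v' - v) - L * v ^ 2 ≤ η' * v' ^ 2 - η * v ^ 2 := by
  have h1 : 0 ≤ η' * (η' * (v' - v) ^ 2 + 2 * (η' - η) * v * (v' - v) + L * v ^ 2) := by
    have h2 : 0 ≤ (L * η' - (η' - η) ^ 2) * v ^ 2 :=
      mul_nonneg (by linarith) (sq_nonneg v)
    nlinarith [sq_nonneg (η' * (v' - v) + (η' - η) * v)]
  have h3 := nonneg_of_mul_nonneg_right h1 hη'
  nlinarith

/-- Interior gradient estimate for discrete harmonic functions (Bernstein's method). -/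
theorem sq_gradient_le (u : (Fin d → ℤ) → ℝ) (x : Fin d → ℤ) (i : Fin d) {R M : ℝ} (hR : 1 ≤ R)
    (hharm : ∀ y, latNorm (y - x) ≤ R + 1 → lap u y = 0)
    (hM : ∀ y, latNorm (y - x) ≤ R + 1 → |u y| ≤ M) :
    (u (x + Pi.single i 1) - u x) ^ 2 ≤ (40 + 328 * d) * (M / R) ^ 2 := by
  have hR0 : 0 < R := by linarith
  set q : (Fin d → ℤ) → ℝ := fun y => sqNorm (y - x) with hq
  have hqR : ∀ y, q y ≤ R ^ 2 → latNorm (y - x) ≤ R := fun y hy =>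
    abs_le_of_sq_le_sq' (by rw [latNorm_sq]; exact hy) hR0.le |>.2
  have hqadd : ∀ y j, q (y + Pi.single j 1) = q y + 2 * ((y j : ℝ) - x j) + 1 := fun y j => by
    simp only [hq]
    rw [add_sub_right_comm, sqNorm_add_single_one]
    simp
  have hqsub : ∀ y j, q (y - Pi.single j 1) = q y - 2 * ((y j : ℝ) - x j) + 1 := fun y j => by
    simp only [hq]
    rw [sub_right_comm, sqNorm_sub_single_one]
    simp
  have hcoord : ∀ y j, ((y j : ℝ) - x j) ^ 2 ≤ q y := fun y j => by
    simpa using sq_le_sqNorm (y - x) j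
  have hstep : ∀ y, q y ≤ R ^ 2 → ∀ j, |q (y + Pi.single j 1) - q y| ≤ 3 * R ∧
      |q (y - Pi.single j 1) - q y| ≤ 3 * R := by
    intro y hy j
    have h := abs_le.1 (abs_le_of_sq_le_sq ((hcoord y j).trans hy) hR0.le)
    rw [hqadd, hqsub]
    constructor <;> rw [abs_le] <;> constructor <;> linarith [h.1, h.2]
  have hnorm : ∀ y, q y ≤ R ^ 2 → latNorm (y - x) ≤ R + 1 ∧
      latNorm (y + Pi.single i 1 - x) ≤ R + 1 := by
    intro y hy
    have h := hqR y hy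
    refine ⟨by linarith, ?_⟩
    rw [add_sub_right_comm]
    refine (latNorm_add_le _ _).trans ?_
    rw [latNorm_single]
    linarith
  set v : (Fin d → ℤ) → ℝ := fun y => u (y + Pi.single i 1) - u y with hv
  have hlapu : ∀ y, q y ≤ R ^ 2 → lap u y = 0 := fun y hy => hharm y (hnorm y hy).1
  have hlapv : ∀ y, q y ≤ R ^ 2 → lap v y = 0 := fun y hy => by
    have h : lap v y = lap u (y + Pi.single i 1) - lap u y := by
      simp only [lap, hv, ← Finset.sum_sub_distrib]
      refine Finset.sum_congr rfl fun j _ => ?_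
      rw [add_right_comm y (Pi.single j 1), sub_add_eq_add_sub y]
      ring
    rw [h, hlapu y hy, hharm _ (hnorm y hy).2, sub_zero]
  have huM : ∀ y, q y ≤ R ^ 2 → u y ^ 2 ≤ M ^ 2 ∧ v y ^ 2 ≤ 4 * M ^ 2 := by
    intro y hy
    have h1 := abs_le.1 (hM y (hnorm y hy).1)
    have h2 := abs_le.1 (hM _ (hnorm y hy).2)
    refine ⟨sq_le_sq' h1.1 h1.2, ?_⟩
    rw [show 4 * M ^ 2 = (2 * M) ^ 2 by ring]
    apply sq_le_sq' <;> simp only [hv] <;> linarith [h1.1, h1.2, h2.1, h2.2]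
  set η : (Fin d → ℤ) → ℝ := fun y => (R ^ 2 - q y) ^ 2 + R ^ 2 with hη
  have hη0 : ∀ y, 0 < η y := fun y => by positivity
  set F : (Fin d → ℤ) → ℝ := fun y => η y * v y ^ 2 + 328 * d * R ^ 2 * u y ^ 2 with hF
  have hηstep : ∀ y z, |q z - q y| ≤ 3 * R → (η z - η y) ^ 2 ≤ 162 * R ^ 2 * η z := by
    intro y z hzy
    have h1 : (q z - q y) ^ 2 ≤ 9 * R ^ 2 := by
      have := sq_le_sq' (abs_le.1 hzy).1 (abs_le.1 hzy).2
      linarith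
    have h2 : η z - η y = (q y - q z) * (2 * (R ^ 2 - q z) - (q y - q z)) := by
      simp only [hη]; ring
    have h3 : (2 * (R ^ 2 - q z) - (q y - q z)) ^ 2 ≤ 18 * η z := by
      simp only [hη]
      nlinarith [sq_nonneg (2 * (R ^ 2 - q z) + (q y - q z)), sq_nonneg (R ^ 2 - q z)]
    rw [h2, mul_pow]
    calc (q y - q z) ^ 2 * (2 * (R ^ 2 - q z) - (q y - q z)) ^ 2
        ≤ (9 * R ^ 2) * (18 * η z) := by
          refine mul_le_mul (by linarith) h3 (sq_nonneg _) (by positivity)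
      _ = 162 * R ^ 2 * η z := by ring
  have hlapF : ∀ y, q y ≤ R ^ 2 → 0 ≤ lap F y := by
    intro y hy
    have hq0 : 0 ≤ q y := sqNorm_nonneg _
    have hηv : ∀ j, -(328 * R ^ 2 * v y ^ 2)
        + 2 * η y * v y * (v (y + Pi.single j 1) + v (y - Pi.single j 1) - 2 * v y)
        ≤ η (y + Pi.single j 1) * v (y + Pi.single j 1) ^ 2
          + η (y - Pi.single j 1) * v (y - Pi.single j 1) ^ 2 - 2 * (η y * v y ^ 2) := by
      intro j
      have h1 := cutoff_mul_sq_sub_ge (v := v y) (v' := v (y + Pi.single j 1)) (hη0 _)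
        (hηstep y _ (hstep y hy j).1)
      have h2 := cutoff_mul_sq_sub_ge (v := v y) (v' := v (y - Pi.single j 1)) (hη0 _)
        (hηstep y _ (hstep y hy j).2)
      have h3 : -(4 * R ^ 2) ≤ η (y + Pi.single j 1) + η (y - Pi.single j 1) - 2 * η y := by
        simp only [hη, hqadd, hqsub]
        nlinarith [sq_nonneg (2 * ((y j : ℝ) - x j) + 1), sq_nonneg (2 * ((y j : ℝ) - x j) - 1)]
      have h4 := mul_le_mul_of_nonneg_right h3 (sq_nonneg (v y))
      linarith
    have hu2 : lap (fun z => u z ^ 2) y =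
        ∑ j, ((u (y + Pi.single j 1) - u y) ^ 2 + (u (y - Pi.single j 1) - u y) ^ 2) := by
      have h : lap (fun z => u z ^ 2) y = 2 * u y * lap u y +
          ∑ j, ((u (y + Pi.single j 1) - u y) ^ 2 + (u (y - Pi.single j 1) - u y) ^ 2) := by
        simp only [lap, Finset.mul_sum, ← Finset.sum_add_distrib]
        exact Finset.sum_congr rfl fun j _ => by ring
      rw [h, hlapu y hy, mul_zero, zero_add]
    have hu2' : v y ^ 2 ≤ lap (fun z => u z ^ 2) y := by
      rw [hu2]
      refine le_trans ?_ (Finset.single_le_sum (fun j _ => by positivity) (Finset.mem_univ i))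
      simp only [hv]
      linarith [sq_nonneg (u (y - Pi.single i 1) - u y)]
    have hηv' : -(328 * d * R ^ 2 * v y ^ 2) ≤ lap (fun z => η z * v z ^ 2) y := by
      have h := Finset.sum_le_sum fun j (_ : j ∈ Finset.univ) => hηv j
      rw [Finset.sum_add_distrib, ← Finset.mul_sum] at h
      have h' : ∑ j, (v (y + Pi.single j 1) + v (y - Pi.single j 1) - 2 * v y) = 0 := hlapv y hy
      rw [h', mul_zero, add_zero] at h
      refine le_trans (le_of_eq ?_) h
      simp
      ring
    have h1 : 328 * d * R ^ 2 * v y ^ 2 ≤ 328 * d * R ^ 2 * lap (fun z => u z ^ 2) y := by gcongr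
    simp only [hF]
    rw [lap_add, lap_const_mul]
    linarith
  set B := (40 + 328 * d) * R ^ 2 * M ^ 2 with hB
  have hshell : ∀ y z, q y ≤ R ^ 2 → R ^ 2 < q z → |q z - q y| ≤ 3 * R → F y ≤ B := by
    intro y z hy hz hzy
    have h1 : η y ≤ 10 * R ^ 2 := by
      have : (R ^ 2 - q y) ^ 2 ≤ (3 * R) ^ 2 :=
        sq_le_sq' (by linarith) (by linarith [(abs_le.1 hzy).2])
      simp only [hη]
      linarith
    have h2 := huM y hy
    calc F y ≤ 10 * R ^ 2 * (4 * M ^ 2) + 328 * d * R ^ 2 * M ^ 2 := by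
          exact add_le_add (mul_le_mul h1 h2.2 (sq_nonneg _) (by positivity))
            (mul_le_mul_of_nonneg_left h2.1 (by positivity))
      _ = B := by rw [hB]; ring
  have hfinal : F x ≤ B := by
    have hq0 : q x ≤ R ^ 2 := by simp [hq, sqNorm]; positivity
    have hmax := nonpos_of_subharmonic_of_finite (Fin.pos i)
      (u := fun y => if q y ≤ R ^ 2 then F y - B else 0) (fun ε hε => ?_) (fun y hy => ?_) x
    · rw [if_pos hq0] at hmax
      linarith
    · refine ((finite_sqNorm_le (R ^ 2)).image (· + x)).subset fun y hy => ?_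
      refine ⟨y - x, ?_, sub_add_cancel _ _⟩
      by_contra hyx
      have hyq : ¬ q y ≤ R ^ 2 := hyx
      have hy' : ε < if q y ≤ R ^ 2 then F y - B else 0 := hy
      rw [if_neg hyq] at hy'
      linarith
    · have hyq : q y ≤ R ^ 2 := by
        by_contra hyq
        rw [if_neg hyq] at hy
        exact lt_irrefl _ hy
      rw [if_pos hyq] at hy
      have hin : ∀ z, |q z - q y| ≤ 3 * R → q z ≤ R ^ 2 := fun z hz => by
        by_contra! hzq
        linarith [hshell y z hyq hzq hz]
      have heq : lap (fun y => if q y ≤ R ^ 2 then F y - B else 0) y = lap F y := by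
        simp only [lap]
        refine Finset.sum_congr rfl fun j _ => ?_
        rw [if_pos hyq, if_pos (hin _ (hstep y hyq j).1), if_pos (hin _ (hstep y hyq j).2)]
        ring
      rw [heq]
      exact hlapF y hyq
  have hηx : R ^ 4 ≤ η x := by
    have : q x = 0 := by simp [hq, sqNorm]
    simp only [hη, this]
    nlinarith [sq_nonneg R]
  have h1 : R ^ 4 * v x ^ 2 ≤ B := by
    have h2 : R ^ 4 * v x ^ 2 ≤ η x * v x ^ 2 := by gcongr
    have h3 : 0 ≤ 328 * d * R ^ 2 * u x ^ 2 := by positivity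
    simp only [hF] at hfinal
    linarith
  show v x ^ 2 ≤ _
  have h4 : (40 + 328 * d) * (M / R) ^ 2 = B / R ^ 4 := by rw [hB]; field_simp
  rw [h4, le_div_iff₀ (by positivity)]
  linarith

lemma normPow_bounds (hd : 2 ≤ d) (x : Fin d → ℤ) :
    1 / (latNorm x + 1) ^ (d - 2) ≤ normPow ((d - 2) / 2) x ∧
      normPow ((d - 2) / 2) x ≤ 2 ^ (d - 2) / (latNorm x + 1) ^ (d - 2) := by
  have hs : 0 < sqNorm x + 1 := by linarith [sqNorm_nonneg x]
  have hℓ := latNorm_nonneg x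
  have hr0 : 0 < √(sqNorm x + 1) := Real.sqrt_pos.2 hs
  have hN : normPow ((d - 2) / 2) x = 1 / √(sqNorm x + 1) ^ (d - 2) := by
    rw [normPow, Real.rpow_neg hs.le, one_div, Real.sqrt_eq_rpow, ← Real.rpow_natCast,
      ← Real.rpow_mul hs.le, Nat.cast_sub hd]
    congr 2
    push_cast
    ring
  have h1 : √(sqNorm x + 1) ≤ latNorm x + 1 := by
    rw [Real.sqrt_le_left (by linarith), ← latNorm_sq]
    nlinarith
  have h2 : latNorm x + 1 ≤ 2 * √(sqNorm x + 1) := by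
    have h3 : latNorm x ≤ √(sqNorm x + 1) := Real.le_sqrt_of_sq_le (by rw [latNorm_sq]; linarith)
    have h4 : 1 ≤ √(sqNorm x + 1) := Real.one_le_sqrt.2 (by linarith [sqNorm_nonneg x])
    linarith
  rw [hN]
  refine ⟨one_div_le_one_div_of_le (by positivity) (pow_le_pow_left₀ hr0.le h1 _), ?_⟩
  rw [div_le_div_iff₀ (by positivity) (by positivity), one_mul, ← mul_pow]
  exact pow_le_pow_left₀ (by positivity) h2 _

/-- A decaying upper bound of order `|x|^{2-d}` for the Green's function improves to a gradient
bound of order `|x|^{1-d}`. -/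
lemma abs_gradient_le {G : (Fin d → ℤ) → ℝ} (hd : 2 ≤ d)
    (hG : ∀ x, lap G x = if x = 0 then -1 else 0) {C : ℝ} (hC : 0 < C)
    (hGC : ∀ x, |G x| ≤ C / (latNorm x + 1) ^ (d - 2)) (x : Fin d → ℤ) (i : Fin d) :
    |G (x + Pi.single i 1) - G x|
      ≤ (2 * 5 ^ (d - 1) + 8 * (40 + 328 * d) * 2 ^ (d - 2)) * C / (latNorm x + 1) ^ (d - 1) := by
  have hℓ := latNorm_nonneg x
  have hpow : (latNorm x + 1) ^ (d - 1) = (latNorm x + 1) ^ (d - 2) * (latNorm x + 1) := by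
    rw [← pow_succ]
    congr 1
    omega
  rcases lt_or_ge (latNorm x) 4 with hx | hx
  · have hle : ∀ y, |G y| ≤ C := fun y => (hGC y).trans
      (div_le_self hC.le (one_le_pow₀ (by linarith [latNorm_nonneg y])))
    have h1 : |G (x + Pi.single i 1) - G x| ≤ 2 * C := by
      have := abs_sub (G (x + Pi.single i 1)) (G x)
      linarith [hle x, hle (x + Pi.single i 1)]
    have h2 : (latNorm x + 1) ^ (d - 1) ≤ 5 ^ (d - 1) :=
      pow_le_pow_left₀ (by linarith) (by linarith) _
    rw [le_div_iff₀ (by positivity)]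
    calc _ ≤ 2 * C * 5 ^ (d - 1) := mul_le_mul h1 h2 (by positivity) (by positivity)
      _ = (2 * 5 ^ (d - 1)) * C := by ring
      _ ≤ _ := by
        refine mul_le_mul_of_nonneg_right ?_ hC.le
        exact le_add_of_nonneg_right (by positivity)
  · have hfar : ∀ y, latNorm (y - x) ≤ latNorm x / 4 + 1 → latNorm x / 2 ≤ latNorm y := by
      intro y hy
      have h := latNorm_add_le y (-(y - x))
      rw [latNorm_neg, ← sub_eq_add_neg, sub_sub_cancel] at h
      linarith
    set M := 2 ^ (d - 2) * C / (latNorm x + 1) ^ (d - 2) with hM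
    have hM0 : 0 < M := by positivity
    have h := sq_gradient_le G x i (R := latNorm x / 4) (M := M) (by linarith)
      (fun y hy => by
        rw [hG, if_neg]
        rintro rfl
        have := hfar 0 hy
        rw [latNorm_zero] at this
        linarith)
      (fun y hy => by
        refine (hGC y).trans ?_
        rw [hM, div_le_div_iff₀ (by have := latNorm_nonneg y; positivity) (by positivity),
          mul_comm (2 ^ (d - 2)) C, mul_assoc, ← mul_pow]
        refine mul_le_mul_of_nonneg_left (pow_le_pow_left₀ (by positivity) ?_ _) hC.le
        linarith [hfar y hy])
    set A : ℝ := 40 + 328 * d with hA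
    have hA1 : 1 ≤ A := by
      have : (0 : ℝ) ≤ d := Nat.cast_nonneg d
      linarith
    have hMR : M / (latNorm x / 4) ≤ 8 * M / (latNorm x + 1) := by
      rw [div_le_div_iff₀ (by linarith) (by linarith)]
      nlinarith
    have h2 : |G (x + Pi.single i 1) - G x| ≤ A * (8 * M / (latNorm x + 1)) := by
      refine abs_le_of_sq_le_sq (h.trans ?_) (by positivity)
      rw [mul_pow]
      have h3 : A ≤ A ^ 2 := by nlinarith
      have h4 : 0 ≤ M / (latNorm x / 4) := by positivity
      gcongr
    refine h2.trans ?_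
    rw [hM, hpow, le_div_iff₀ (by positivity)]
    have h5 : A * (8 * (2 ^ (d - 2) * C / (latNorm x + 1) ^ (d - 2)) / (latNorm x + 1))
        * ((latNorm x + 1) ^ (d - 2) * (latNorm x + 1)) = 8 * A * 2 ^ (d - 2) * C := by
      field_simp
    rw [h5]
    refine mul_le_mul_of_nonneg_right ?_ hC.le
    exact le_add_of_nonneg_left (by positivity)

end LatticeGreen

/-- Bounds on the lattice Green's function in dimension `d ≥ 3`: if `G : ℤ^d → ℝ`
satisfies `−ΔG = δ₀` (with the discrete Laplacian) and `G(x) → 0` as `|x| → ∞`, then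
there are `c = c(d) > 0` and `C = C(d) < ∞` with
`c/|x|₊^{d−2} ≤ G(x) ≤ C/|x|₊^{d−2}` and `|∇G(x)| ≤ C/|x|₊^{d−1}` for all `x`. -/
theorem lattice_green_function_bounds (d : ℕ) (hd : 3 ≤ d) (G : (Fin d → ℤ) → ℝ)
    (hG : ∀ x : Fin d → ℤ,
      -(∑ i : Fin d, (G (x + Pi.single i 1) + G (x - Pi.single i 1) - 2 * G x))
        = if x = 0 then (1 : ℝ) else 0)
    (hdecay : ∀ ε : ℝ, 0 < ε → ∃ R : ℝ, ∀ x : Fin d → ℤ, R ≤ latNorm x → |G x| ≤ ε) :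
    ∃ c C : ℝ, 0 < c ∧ 0 < C ∧ ∀ x : Fin d → ℤ,
      (c / (latNorm x + 1) ^ (d - 2) ≤ G x ∧ G x ≤ C / (latNorm x + 1) ^ (d - 2)) ∧
      Real.sqrt (∑ i : Fin d, (G (x + Pi.single i 1) - G x) ^ 2)
        ≤ C / (latNorm x + 1) ^ (d - 1) := by
  open LatticeGreen in
  have hlap : ∀ x, lap G x = if x = 0 then -1 else 0 := fun x => by
    rw [lap, ← neg_inj, hG]
    split_ifs <;> simp
  have hfin : ∀ ε > 0, {x | ε < |G x|}.Finite := fun ε hε => by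
    obtain ⟨R, hR⟩ := hdecay ε hε
    refine (finite_sqNorm_le (R ^ 2)).subset fun x hx => ?_
    have hxR : latNorm x < R := by
      by_contra! h
      exact absurd (hR x h) (not_le.2 hx)
    show sqNorm x ≤ R ^ 2
    rw [← latNorm_sq]
    exact pow_le_pow_left₀ (latNorm_nonneg x) hxR.le 2
  obtain ⟨c, hc, C₀, hC₀, hb⟩ := exists_green_bounds hd hlap hfin
  set C := C₀ * 2 ^ (d - 2) with hC
  have hC0 : 0 < C := by positivity
  have hlow : ∀ x, c / (latNorm x + 1) ^ (d - 2) ≤ G x := fun x => by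
    refine le_trans ?_ (hb x).1
    rw [div_eq_mul_one_div]
    exact mul_le_mul_of_nonneg_left (normPow_bounds (by omega) x).1 hc.le
  have hup : ∀ x, G x ≤ C / (latNorm x + 1) ^ (d - 2) := fun x => by
    refine (hb x).2.trans ?_
    rw [hC, mul_div_assoc]
    exact mul_le_mul_of_nonneg_left (normPow_bounds (by omega) x).2 hC₀.le
  have hgrad := abs_gradient_le (by omega) hlap hC0 fun x => by
    rw [abs_of_nonneg (le_trans (by have := latNorm_nonneg x; positivity) (hlow x))]
    exact hup x
  set D : ℝ := (2 * 5 ^ (d - 1) + 8 * (40 + 328 * d) * 2 ^ (d - 2)) * C with hD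
  have hD0 : 0 < D := by positivity
  refine ⟨c, C + d * D, hc, by positivity, fun x => ⟨⟨hlow x, (hup x).trans ?_⟩, ?_⟩⟩
  · have := latNorm_nonneg x
    gcongr
    exact le_add_of_nonneg_right (by positivity)
  · have hℓ := latNorm_nonneg x
    calc √(∑ i, (G (x + Pi.single i 1) - G x) ^ 2)
        ≤ ∑ i, |G (x + Pi.single i 1) - G x| := by
          refine Real.sqrt_le_iff.2 ⟨Finset.sum_nonneg fun _ _ => abs_nonneg _, ?_⟩
          simpa using Finset.sum_sq_le_sq_sum_of_nonneg (s := Finset.univ)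
            (f := fun i => |G (x + Pi.single i 1) - G x|) fun _ _ => abs_nonneg _
      _ ≤ d * (D / (latNorm x + 1) ^ (d - 1)) := by
          refine (Finset.sum_le_card_nsmul _ _ _ fun i _ => hgrad x i).trans ?_
          simp
      _ = d * D / (latNorm x + 1) ^ (d - 1) := by ring
      _ ≤ (C + d * D) / (latNorm x + 1) ^ (d - 1) := by
          gcongr
          exact le_add_of_nonneg_left hC0.le
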